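/- There exists a constant K > 0 such that for every ℓ ≥ 2, every integer 1 ≤ l ≤ ℓ, every word c ∈ {0,1,2}^l, every comparison relation ∼ ∈ {=, <, ≤, >, ≥} (lexicographic on words of length l, with 0 < 1 < 2), and every even permutation g of the ghost set G, the conditioned gate π_{id×g, C} belongs to G_ℓ with word norm at most K·l², where C is the condition consisting of those head-containing configurations whose l tape letters a₀ a₁ ⋯ a_{l−1} read from the head position (a₀ being the head's own tape letter) satisfy a₀⋯a_{l−1} ∼ c. -/

import Mathlib

/-- The word norm of `g` with respect to the generating set `F`:
the least `n` such that `g` is a product of `n` elements of `F ∪ F⁻¹`. -/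
noncomputable def wordNorm {G : Type*} [Group G] (F : Set G) (g : G) : ℕ :=
  sInf {n : ℕ | ∃ w : List G, w.length = n ∧ (∀ x ∈ w, x ∈ F ∨ x⁻¹ ∈ F) ∧ w.prod = g}
/-! ### Turing machine symbols and local step functions -/

/-- Tape/head symbols: a plain tape letter, or a head `(q, a)` on top of letter `a`. -/
abbrev TSym (Q Γ : Type) : Type := Γ ⊕ (Q × Γ)

/-- The tape letter carried by a cell (under the head if the cell carries the head). -/
def tapeLetter {Q Γ : Type} : TSym Q Γ → Γ
  | Sum.inl a => a
  | Sum.inr (_, a) => a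

/-- A complete deterministic machine is given by a head-step function: at `(q, a)` it either
rewrites the head in place (`.inl (q', b)`, a matching transition), or moves in direction
`δ ∈ {+1, -1}` into state `q'` (`.inr (δ, q')`, a move transition). -/
abbrev HeadStep (Q Γ : Type) : Type := Q → Γ → ((Q × Γ) ⊕ (ℤ × Q))

/-- If the symbol `s` carries a head about to move in direction `d`, the state in which the
head arrives; `none` otherwise. -/
def arrivesAs {Q Γ : Type} (δ : HeadStep Q Γ) (s : TSym Q Γ) (d : ℤ) : Option Q :=
  match s with
  | Sum.inl _ => none
  | Sum.inr (q, a) =>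
    match δ q a with
    | Sum.inl _ => none
    | Sum.inr (d', q') => if d' = d then some q' else none

/-- The local rule of the moving-head dynamics: the new symbol of a cell, given the symbols
`l, c, r` of its left neighbour, itself, and its right neighbour. -/
def localStep {Q Γ : Type} (δ : HeadStep Q Γ) (l c r : TSym Q Γ) : TSym Q Γ :=
  match c with
  | Sum.inr (q, a) =>
    (match δ q a with
     | Sum.inl qb => Sum.inr qb
     | Sum.inr _ => Sum.inl a)
  | Sum.inl a =>
    (match arrivesAs δ l 1 with
     | some q' => Sum.inr (q', a)
     | none =>
       match arrivesAs δ r (-1) with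
       | some q' => Sum.inr (q', a)
       | none => Sum.inl a)

/-- The moving-head action of a complete deterministic machine on bi-infinite tapes. -/
def stepZ {Q Γ : Type} (δ : HeadStep Q Γ) (x : ℤ → TSym Q Γ) : ℤ → TSym Q Γ :=
  fun i => localStep δ (x (i - 1)) (x i) (x (i + 1))

/-- The action of a complete deterministic machine on cyclic tapes of length `ℓ`. -/
def stepC {Q Γ : Type} (δ : HeadStep Q Γ) (ℓ : ℕ) (w : ZMod ℓ → TSym Q Γ) :
    ZMod ℓ → TSym Q Γ :=
  fun i => localStep δ (w (i - 1)) (w i) (w (i + 1))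

/-- A configuration has at most one head. -/
def AtMostOneHeadZ {Q Γ : Type} (x : ℤ → TSym Q Γ) : Prop :=
  ∀ i j : ℤ, (x i).isRight = true → (x j).isRight = true → i = j

/-- A cyclic configuration has at most one head. -/
def AtMostOneHeadC {Q Γ : Type} {ℓ : ℕ} (w : ZMod ℓ → TSym Q Γ) : Prop :=
  ∀ i j : ZMod ℓ, (w i).isRight = true → (w j).isRight = true → i = j

/-! ### The SMART machine -/

/-- The four arrows `▶, ◀, ▷, ◁` (filled right/left, hollow right/left). -/
inductive Arrow : Type
  | rf  -- ▶ (filled right)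
  | lf  -- ◀ (filled left)
  | rh  -- ▷ (hollow right)
  | lh  -- ◁ (hollow left)
deriving DecidableEq

/-- The SMART state set `Q̊`: an arrow with a subscript in `{1,2}`; the subscript `b`
is represented by the `Fin 2` value `b - 1`. -/
abbrev SQ : Type := Arrow × Fin 2

/-- The SMART tape alphabet `{0,1,2}`. -/
abbrev Letter : Type := Fin 3

/-- The head-step function of the SMART machine.  States `q₂` (second component `1`) are
move states; states `q₁` (second component `0`) are matching states. -/
def smartStep : HeadStep SQ Letter := fun q a =>
  if q.2 = 1 then
    match q.1 with
    | .rf => Sum.inr (1, (.rf, 0))   -- (▶₂, +1, ▶₁)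
    | .lf => Sum.inr (-1, (.lf, 0))  -- (◀₂, −1, ◀₁)
    | .rh => Sum.inr (1, (.rh, 0))   -- (▷₂, +1, ▷₁)
    | .lh => Sum.inr (-1, (.lh, 0))  -- (◁₂, −1, ◁₁)
  else
    match q.1 with
    | .rf => Sum.inl (if a = 0 then ((.lf, 1), 1) else if a = 1 then ((.lh, 1), 1) else ((.lh, 1), 2))
    | .lf => Sum.inl (if a = 0 then ((.rf, 1), 1) else if a = 1 then ((.rh, 1), 1) else ((.rh, 1), 2))
    | .rh => Sum.inl (if a = 0 then ((.rf, 1), 2) else if a = 1 then ((.rf, 1), 0) else ((.lh, 1), 0))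
    | .lh => Sum.inl (if a = 0 then ((.lf, 1), 2) else if a = 1 then ((.lf, 1), 0) else ((.rh, 1), 0))

/-! ### The decorated SMART machine -/

/-- The state set of the decorated SMART machine: a SMART state together with a *duck*
`d ∈ {d₀, d₁}` (as `Fin 2`, `0 ↦ d₀`) and a *ghost* `x ∈ {0,…,5}` (as `Fin 6`). -/
abbrev DQ : Type := SQ × Fin 2 × Fin 6

/-- The head-step function of the decorated SMART machine: it acts as SMART on the
`Q̊`-component and carries the duck and ghost unchanged. -/
def decStep : HeadStep DQ Letter := fun q a =>
  match smartStep q.1 a with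
  | Sum.inl (q', b) => Sum.inl ((q', q.2), b)
  | Sum.inr (d, q') => Sum.inr (d, (q', q.2))

/-! ### The group `G_ℓ` of Turing machine instructions on cyclic tapes -/

/-- Cyclic configurations of length `ℓ` with at most one head. -/
abbrev CConf (Q Γ : Type) (ℓ : ℕ) : Type :=
  {w : ZMod ℓ → TSym Q Γ // AtMostOneHeadC w}

/-- The pointwise action on symbols of a permutation `g` of head symbols. -/
def gateApply {Q Γ : Type} (g : Equiv.Perm (Q × Γ)) : TSym Q Γ → TSym Q Γ
  | Sum.inl a => Sum.inl a
  | Sum.inr h => Sum.inr (g h)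

/-- `π` is the unary gate `π_g`: it applies `g` to the head symbol (if a head is present)
and fixes all other cells. -/
def IsUnaryGate {Q Γ : Type} {ℓ : ℕ} (g : Equiv.Perm (Q × Γ))
    (π : Equiv.Perm (CConf Q Γ ℓ)) : Prop :=
  ∀ w : CConf Q Γ ℓ, ∀ i : ZMod ℓ, (π w).1 i = gateApply g (w.1 i)

/-- `π` is the state-dependent right move `ρ_q`: it moves a head in state `q` one position
to the right (mod `ℓ`), leaving its tape letter behind and picking up the next cell's
letter, and fixes configurations whose head is not in state `q`. -/
def IsMoveGate {Q Γ : Type} [DecidableEq Q] {ℓ : ℕ} (q : Q)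
    (π : Equiv.Perm (CConf Q Γ ℓ)) : Prop :=
  ∀ w : CConf Q Γ ℓ,
    ((∀ i a, w.1 i ≠ Sum.inr (q, a)) → π w = w) ∧
    (∀ i a, w.1 i = Sum.inr (q, a) →
      ∀ j : ZMod ℓ, (π w).1 j =
        if j = i + 1 then Sum.inr (q, tapeLetter (w.1 (i + 1)))
        else if j = i then Sum.inl a
        else w.1 j)

/-- The generating set of the group `G_ℓ` of Turing machine instructions: all unary gates
`π_g` and all state-dependent moves `ρ_q`. -/
def TMGens (Q Γ : Type) [DecidableEq Q] (ℓ : ℕ) : Set (Equiv.Perm (CConf Q Γ ℓ)) :=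
  {π | (∃ g, IsUnaryGate g π) ∨ (∃ q, IsMoveGate q π)}

/-- The five lexicographic comparison relations `=, <, ≤, >, ≥`. -/
inductive CmpRel : Type
  | eq | lt | le | gt | ge
deriving DecidableEq

/-- Strict lexicographic order on the first `l` letters (with `0 < 1 < 2`). -/
def lexLt (l : ℕ) (u v : ℕ → Letter) : Prop :=
  ∃ t : ℕ, t < l ∧ (∀ s : ℕ, s < t → u s = v s) ∧ u t < v t

/-- The comparison `u ∼ v` on words of length `l`, for `∼ ∈ {=, <, ≤, >, ≥}`. -/
def lexHolds (r : CmpRel) (l : ℕ) (u v : ℕ → Letter) : Prop :=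
  match r with
  | .eq => ∀ t : ℕ, t < l → u t = v t
  | .lt => lexLt l u v
  | .le => lexLt l u v ∨ ∀ t : ℕ, t < l → u t = v t
  | .gt => lexLt l v u
  | .ge => lexLt l v u ∨ ∀ t : ℕ, t < l → u t = v t

/-- The word of tape letters of `w` read rightwards from position `i₀` (the letter under
the head first). -/
def readWord (ℓ : ℕ) (w : ZMod ℓ → TSym DQ Letter) (i₀ : ZMod ℓ) : ℕ → Letter :=
  fun t => tapeLetter (w (i₀ + (t : ZMod ℓ)))

open scoped commutatorElement

/-! ### Elements of bounded word length -/

/-- `g` is a product of at most `n` elements of `F ∪ F⁻¹`. -/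
def WordBound {G : Type*} [Group G] (F : Set G) (n : ℕ) (g : G) : Prop :=
  ∃ w : List G, w.length ≤ n ∧ (∀ x ∈ w, x ∈ F ∨ x⁻¹ ∈ F) ∧ w.prod = g

namespace WordBound

variable {G : Type*} [Group G] {F : Set G} {m n : ℕ} {g h : G}

theorem mono (hg : WordBound F m g) (hmn : m ≤ n) : WordBound F n g := by
  obtain ⟨w, hw, hF, hp⟩ := hg
  exact ⟨w, hw.trans hmn, hF, hp⟩

theorem one : WordBound F n (1 : G) := ⟨[], by simp, by simp, by simp⟩

theorem of_mem (hg : g ∈ F) : WordBound F 1 g := ⟨[g], by simp, by simp [hg], by simp⟩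

theorem mul (hg : WordBound F m g) (hh : WordBound F n h) : WordBound F (m + n) (g * h) := by
  obtain ⟨v, hv, hFv, rfl⟩ := hg
  obtain ⟨w, hw, hFw, rfl⟩ := hh
  refine ⟨v ++ w, by simp only [List.length_append]; omega, ?_, by simp⟩
  intro x hx
  rcases List.mem_append.1 hx with hx | hx
  exacts [hFv x hx, hFw x hx]

theorem inv (hg : WordBound F n g) : WordBound F n g⁻¹ := by
  obtain ⟨w, hw, hF, rfl⟩ := hg
  refine ⟨(w.map (·⁻¹)).reverse, by simpa using hw, ?_, (List.prod_inv_reverse w).symm⟩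
  intro x hx
  simp only [List.mem_reverse, List.mem_map] at hx
  obtain ⟨y, hy, rfl⟩ := hx
  simpa using (hF y hy).symm

theorem pow (hg : WordBound F n g) (k : ℕ) : WordBound F (k * n) (g ^ k) := by
  induction k with
  | zero => simpa using one
  | succ k ih => rw [pow_succ, Nat.succ_mul]; exact ih.mul hg

theorem mem_closure (hg : WordBound F n g) : g ∈ Subgroup.closure F := by
  obtain ⟨w, -, hF, rfl⟩ := hg
  refine Subgroup.list_prod_mem _ fun x hx => ?_
  rcases hF x hx with h | h
  · exact Subgroup.subset_closure h
  · simpa using inv_mem (Subgroup.subset_closure (k := F) h)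

theorem wordNorm_le (hg : WordBound F n g) : wordNorm F g ≤ n := by
  obtain ⟨w, hw, hF, hp⟩ := hg
  exact (Nat.sInf_le (⟨w, rfl, hF, hp⟩ : w.length ∈ {n : ℕ | ∃ w : List G, w.length = n ∧
    (∀ x ∈ w, x ∈ F ∨ x⁻¹ ∈ F) ∧ w.prod = g})).trans hw

end WordBound

/-! ### Headed configurations -/

instance : Fintype Arrow := ⟨{.rf, .lf, .rh, .lh}, fun x => by cases x <;> simp⟩

/-- Head position, state and tape contents of a headed configuration. -/
abbrev Headed (ℓ : ℕ) : Type := ZMod ℓ × DQ × (ZMod ℓ → Letter)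

/-- The configuration without a head with tape contents `τ`. -/
def blankConf {ℓ : ℕ} (τ : ZMod ℓ → Letter) : CConf DQ Letter ℓ :=
  ⟨fun j => Sum.inl (τ j), fun i j hi _ => by simp at hi⟩

/-- The configuration with prescribed head position, state and tape contents. -/
def headConf {ℓ : ℕ} (x : Headed ℓ) : CConf DQ Letter ℓ :=
  ⟨fun j => if j = x.1 then Sum.inr (x.2.1, x.2.2 j) else Sum.inl (x.2.2 j), fun i j hi hj => by
    by_cases h : i = x.1 <;> by_cases h' : j = x.1 <;> simp_all⟩

theorem tapeLetter_headConf {ℓ : ℕ} (x : Headed ℓ) (j : ZMod ℓ) :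
    tapeLetter ((headConf x).1 j) = x.2.2 j := by
  by_cases h : j = x.1 <;> simp [headConf, h, tapeLetter]

theorem eq_headConf {ℓ : ℕ} (w : CConf DQ Letter ℓ) {i : ZMod ℓ} {q : DQ} {a : Letter}
    (h : w.1 i = Sum.inr (q, a)) : w = headConf (i, q, fun j => tapeLetter (w.1 j)) := by
  refine Subtype.ext (funext fun j => ?_)
  by_cases hj : j = i
  · subst hj
    simp [headConf, h, tapeLetter]
  · rcases hw : w.1 j with b | b
    · simp [headConf, hj, hw, tapeLetter]
    · exact absurd (w.2 j i (by simp [hw]) (by simp [h])) hj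

theorem eq_blankConf {ℓ : ℕ} (w : CConf DQ Letter ℓ) (h : ∀ i, (w.1 i).isLeft = true) :
    w = blankConf fun j => tapeLetter (w.1 j) := by
  refine Subtype.ext (funext fun j => ?_)
  have hj := h j
  rcases hw : w.1 j with b | b
  · simp [blankConf, hw, tapeLetter]
  · simp [hw] at hj

theorem headConf_apply_eq_inr {ℓ : ℕ} {x : Headed ℓ} {i : ZMod ℓ} {q : DQ} {a : Letter} :
    (headConf x).1 i = Sum.inr (q, a) ↔ i = x.1 ∧ x.2.1 = q ∧ x.2.2 i = a := by
  by_cases h : i = x.1 <;> simp [headConf, h]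

/-- Configurations are either blank or headed. -/
noncomputable def confEquiv (ℓ : ℕ) : (ZMod ℓ → Letter) ⊕ Headed ℓ ≃ CConf DQ Letter ℓ :=
  Equiv.ofBijective (Sum.elim blankConf headConf) <| by
    constructor
    · rintro (τ | x) (σ | y) h
      · have h' := fun j => congrFun (congrArg Subtype.val h) j
        simp only [Sum.elim_inl, blankConf, Sum.inl.injEq] at h'
        rw [funext h']
      · have h' := congrFun (congrArg Subtype.val h) y.1
        simp [blankConf, headConf] at h'
      · have h' := congrFun (congrArg Subtype.val h) x.1
        simp [blankConf, headConf] at h'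
      · simp only [Sum.elim_inr] at h
        have ht : x.2.2 = y.2.2 := funext fun j => by
          rw [← tapeLetter_headConf x, ← tapeLetter_headConf y, h]
        have hx : (headConf y).1 x.1 = Sum.inr (x.2.1, x.2.2 x.1) := by
          rw [← h]; simp [headConf]
        obtain ⟨hi, hq, -⟩ := headConf_apply_eq_inr.1 hx
        rw [show x = y from Prod.ext hi (Prod.ext hq.symm ht)]
    · intro w
      by_cases h : ∀ i, (w.1 i).isLeft = true
      · exact ⟨Sum.inl _, (eq_blankConf w h).symm⟩
      · push Not at h
        obtain ⟨i, hi⟩ := h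
        rcases hw : w.1 i with b | ⟨q, a⟩
        · simp [hw] at hi
        · exact ⟨Sum.inr _, (eq_headConf w hw).symm⟩

/-- Extend a permutation of headed configurations by the identity on blank ones. -/
noncomputable def liftPerm (ℓ : ℕ) :
    Equiv.Perm (Headed ℓ) →* Equiv.Perm (CConf DQ Letter ℓ) :=
  ((confEquiv ℓ).permCongrHom.toMonoidHom.comp (Equiv.Perm.sumCongrHom _ _)).comp
    (MonoidHom.inr _ _)

theorem liftPerm_headConf {ℓ : ℕ} (p : Equiv.Perm (Headed ℓ)) (x : Headed ℓ) :
    liftPerm ℓ p (headConf x) = headConf (p x) := by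
  have h (y : Headed ℓ) : headConf y = confEquiv ℓ (Sum.inr y) := rfl
  simp [liftPerm, h, Equiv.permCongrHom]

theorem liftPerm_blankConf {ℓ : ℕ} (p : Equiv.Perm (Headed ℓ)) (τ : ZMod ℓ → Letter) :
    liftPerm ℓ p (blankConf τ) = blankConf τ := by
  have h : blankConf τ = confEquiv ℓ (Sum.inl τ) := rfl
  simp [liftPerm, h, Equiv.permCongrHom]

/-- `p` extends to a product of at most `n` generators of `G_ℓ` and their inverses. -/
def Cost {ℓ : ℕ} (n : ℕ) (p : Equiv.Perm (Headed ℓ)) : Prop :=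
  WordBound (TMGens DQ Letter ℓ) n (liftPerm ℓ p)

namespace Cost

variable {ℓ m n : ℕ} {p p' : Equiv.Perm (Headed ℓ)}

theorem mono (h : Cost m p) (hmn : m ≤ n) : Cost n p := WordBound.mono h hmn

theorem one : Cost n (1 : Equiv.Perm (Headed ℓ)) := by
  simpa only [Cost, map_one] using WordBound.one

theorem mul (h : Cost m p) (h' : Cost n p') : Cost (m + n) (p * p') := by
  simpa only [Cost, map_mul] using WordBound.mul h h'

theorem inv (h : Cost n p) : Cost n p⁻¹ := by
  simpa only [Cost, map_inv] using WordBound.inv h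

theorem pow (h : Cost n p) (k : ℕ) : Cost (k * n) (p ^ k) := by
  simpa only [Cost, map_pow] using WordBound.pow h k

theorem commutator (h : Cost m p) (h' : Cost n p') : Cost (2 * m + 2 * n) ⁅p, p'⁆ := by
  rw [commutatorElement_def]
  exact (((h.mul h').mul h.inv).mul h'.inv).mono (by omega)

end Cost

/-! ### Moves and ghost gates on headed configurations -/

/-- Move the head by `n q` cells to the right when it is in state `q`. -/
def shift {ℓ : ℕ} (n : DQ → ZMod ℓ) : Equiv.Perm (Headed ℓ) where
  toFun x := (x.1 + n x.2.1, x.2)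
  invFun x := (x.1 - n x.2.1, x.2)
  left_inv x := by simp
  right_inv x := by simp

theorem shift_add {ℓ : ℕ} (m n : DQ → ZMod ℓ) : shift (m + n) = shift m * shift n := by
  ext x : 1
  simp only [shift, Equiv.Perm.mul_apply, Equiv.coe_fn_mk, Pi.add_apply]
  rw [add_comm (m _), add_assoc]

theorem shift_pow {ℓ : ℕ} (n : DQ → ZMod ℓ) (k : ℕ) : shift n ^ k = shift (k • n) := by
  induction k with
  | zero => ext x : 1; simp [shift]
  | succ k ih => rw [pow_succ, ih, succ_nsmul, shift_add]

theorem cost_shift_single {ℓ : ℕ} (q : DQ) :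
    Cost 1 (shift (Pi.single q 1 : DQ → ZMod ℓ)) := by
  refine WordBound.of_mem (Or.inr ⟨q, fun w => ⟨fun h => ?_, fun i a h j => ?_⟩⟩)
  · by_cases hw : ∀ i, (w.1 i).isLeft = true
    · rw [eq_blankConf w hw, liftPerm_blankConf]
    · push Not at hw
      obtain ⟨i, hi⟩ := hw
      rcases hi' : w.1 i with b | ⟨q', a⟩
      · simp [hi'] at hi
      · have hq : q' ≠ q := by
          rintro rfl
          exact h i a hi'
        rw [eq_headConf w hi', liftPerm_headConf]
        simp [shift, hq]
  · conv_lhs => rw [eq_headConf w h, liftPerm_headConf]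
    by_cases hj : j = i + 1
    · subst hj
      simp [headConf, shift]
    · by_cases hji : j = i
      · subst hji
        simp only [headConf, shift, Equiv.coe_fn_mk, Pi.single_eq_same, if_neg hj, if_true, h,
          tapeLetter]
      · have hw := congrArg (fun v => v.1 j) (eq_headConf w h)
        simp only [headConf, if_neg hji] at hw
        simpa [headConf, shift, hj, hji] using hw.symm

/-- The number of states of the decorated SMART machine. -/
@[irreducible]
def numStates : ℕ := Fintype.card DQ

theorem cost_shift_one {ℓ : ℕ} : Cost numStates (shift (1 : DQ → ZMod ℓ)) := by
  have key (S : Finset DQ) : Cost S.card (shift (∑ q ∈ S, Pi.single q 1 : DQ → ZMod ℓ)) := by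
    induction S using Finset.induction_on with
    | empty =>
      have : shift (0 : DQ → ZMod ℓ) = 1 := by ext x : 1; simp [shift]
      simpa [this] using Cost.one
    | insert q S hq ih =>
      rw [Finset.sum_insert hq, shift_add, Finset.card_insert_of_notMem hq, add_comm]
      exact (cost_shift_single q).mul ih
  have h1 : (∑ q, Pi.single q 1 : DQ → ZMod ℓ) = 1 := Finset.univ_sum_single _
  rw [numStates]
  simpa only [h1, Finset.card_univ] using key Finset.univ

/-- Apply to the ghost a permutation depending on the head position and the tape. -/
def ghostGate (ℓ : ℕ) :
    (ZMod ℓ × (ZMod ℓ → Letter) → Equiv.Perm (Fin 6)) →* Equiv.Perm (Headed ℓ) where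
  toFun f :=
    { toFun := fun x => (x.1, (x.2.1.1, x.2.1.2.1, f (x.1, x.2.2) x.2.1.2.2), x.2.2)
      invFun := fun x => (x.1, (x.2.1.1, x.2.1.2.1, (f (x.1, x.2.2))⁻¹ x.2.1.2.2), x.2.2)
      left_inv := fun x => by simp
      right_inv := fun x => by simp }
  map_one' := by ext x : 1; simp
  map_mul' f f' := by ext x : 1; simp

theorem cost_ghostGate_letter {ℓ : ℕ} (h : Letter → Equiv.Perm (Fin 6)) :
    Cost 1 (ghostGate ℓ fun y => h (y.2 y.1)) := by
  let g : Equiv.Perm (DQ × Letter) :=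
    { toFun := fun x => ((x.1.1, x.1.2.1, h x.2 x.1.2.2), x.2)
      invFun := fun x => ((x.1.1, x.1.2.1, (h x.2)⁻¹ x.1.2.2), x.2)
      left_inv := fun x => by simp
      right_inv := fun x => by simp }
  refine WordBound.of_mem (Or.inl ⟨g, fun w i => ?_⟩)
  obtain ⟨τ | x, rfl⟩ := (confEquiv ℓ).surjective w
  · change (liftPerm ℓ _ (blankConf τ)).1 i = _
    rw [liftPerm_blankConf]
    rfl
  · change (liftPerm ℓ _ (headConf x)).1 i = gateApply g ((headConf x).1 i)
    rw [liftPerm_headConf]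
    by_cases hi : i = x.1
    · subst hi
      simp [headConf, gateApply, ghostGate, g]
    · simp [headConf, gateApply, ghostGate, hi]

open Classical in
/-- The value `g` when the word read from the head satisfies `P`, and `1` otherwise. -/
noncomputable def onWord {ℓ : ℕ} (P : (ℕ → Letter) → Prop) (g : Equiv.Perm (Fin 6))
    (y : ZMod ℓ × (ZMod ℓ → Letter)) : Equiv.Perm (Fin 6) :=
  if P fun t => y.2 (y.1 + t) then g else 1

/-- The ghost gate of `g` conditioned on the word read from the head satisfying `P`. -/
noncomputable def condGate (ℓ : ℕ) (P : (ℕ → Letter) → Prop) (g : Equiv.Perm (Fin 6)) :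
    Equiv.Perm (Headed ℓ) :=
  ghostGate ℓ (onWord P g)

section condGate

variable {ℓ m n : ℕ} {P P' : (ℕ → Letter) → Prop} {g h : Equiv.Perm (Fin 6)}

theorem condGate_congr (hP : ∀ u, P u ↔ P' u) : condGate ℓ P g = condGate ℓ P' g := by
  rw [show P = P' from funext fun u => propext (hP u)]

theorem condGate_one : condGate ℓ P 1 = 1 := by
  rw [condGate, show onWord (ℓ := ℓ) P 1 = 1 from funext fun y => by simp [onWord], map_one]

theorem condGate_mul : condGate ℓ P (g * h) = condGate ℓ P g * condGate ℓ P h := by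
  rw [condGate, condGate, condGate, ← map_mul]
  congr 1
  funext y
  by_cases hy : P fun t => y.2 (y.1 + t) <;> simp [onWord, hy]

theorem condGate_inv : condGate ℓ P g⁻¹ = (condGate ℓ P g)⁻¹ := by
  rw [eq_inv_iff_mul_eq_one, ← condGate_mul, inv_mul_cancel, condGate_one]

theorem condGate_and :
    condGate ℓ (fun u => P u ∧ P' u) ⁅g, h⁆ = ⁅condGate ℓ P g, condGate ℓ P' h⁆ := by
  rw [condGate, condGate, condGate, ← map_commutatorElement]
  congr 1
  funext y
  by_cases hy : P fun t => y.2 (y.1 + t) <;> by_cases hy' : P' fun t => y.2 (y.1 + t) <;>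
    simp [onWord, hy, hy', commutatorElement_def]

theorem condGate_or (hd : ∀ u, P u → ¬ P' u) :
    condGate ℓ (fun u => P u ∨ P' u) g = condGate ℓ P g * condGate ℓ P' g := by
  rw [condGate, condGate, condGate, ← map_mul]
  congr 1
  funext y
  by_cases hy : P fun t => y.2 (y.1 + t)
  · simp [onWord, hy, hd _ hy]
  · by_cases hy' : P' fun t => y.2 (y.1 + t) <;> simp [onWord, hy, hy']

theorem condGate_shift (m : ℕ) :
    condGate ℓ (fun u => P fun t => u (m + t)) g =
      (shift 1 ^ m)⁻¹ * condGate ℓ P g * shift 1 ^ m := by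
  rw [mul_assoc, eq_inv_mul_iff_mul_eq, shift_pow]
  ext x : 1
  have h : (fun t : ℕ => x.2.2 (x.1 + m + t)) = fun t : ℕ => x.2.2 (x.1 + (m + t : ℕ)) :=
    funext fun t => by rw [Nat.cast_add, add_assoc]
  simp [condGate, ghostGate, onWord, shift]
  rw [h]

theorem Cost.condGate_shift (hc : Cost n (condGate ℓ P g)) (m : ℕ) :
    Cost (n + 2 * (m * numStates)) (condGate ℓ (fun u => P fun t => u (m + t)) g) := by
  have hs := (cost_shift_one (ℓ := ℓ)).pow m
  rw [_root_.condGate_shift]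
  exact ((hs.inv.mul hc).mul hs).mono (by omega)

theorem cost_condGate_letter (S : Letter → Prop) : Cost 1 (condGate ℓ (fun u => S (u 0)) g) := by
  classical
  have h : onWord (ℓ := ℓ) (fun u => S (u 0)) g = fun y => if S (y.2 y.1) then g else 1 :=
    funext fun y => by simp [onWord]
  rw [condGate, h]
  exact cost_ghostGate_letter fun a => if S a then g else 1

end condGate

/-! ### Three-cycles of ghosts -/

theorem Equiv.Perm.IsThreeCycle.exists_commutator {g : Equiv.Perm (Fin 6)}
    (hg : g.IsThreeCycle) :
    ∃ a b : Equiv.Perm (Fin 6), a.IsThreeCycle ∧ b.IsThreeCycle ∧ g = ⁅a, b⁆ := by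
  let x : Equiv.Perm (Fin 6) := Equiv.swap 0 1 * Equiv.swap 0 2
  let y : Equiv.Perm (Fin 6) := Equiv.swap 0 3 * Equiv.swap 0 4
  have hx : x.IsThreeCycle :=
    Equiv.Perm.isThreeCycle_swap_mul_swap_same (by decide) (by decide) (by decide)
  have hy : y.IsThreeCycle :=
    Equiv.Perm.isThreeCycle_swap_mul_swap_same (by decide) (by decide) (by decide)
  have hxy : ⁅x, y⁆.IsThreeCycle := by
    have : ⁅x, y⁆ = Equiv.swap 0 1 * Equiv.swap 0 3 ∨ ⁅x, y⁆ = Equiv.swap 0 3 * Equiv.swap 0 1 ∨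
      ⁅x, y⁆ = Equiv.swap 0 2 * Equiv.swap 0 4 ∨ ⁅x, y⁆ = Equiv.swap 0 4 * Equiv.swap 0 2 ∨
      ⁅x, y⁆ = Equiv.swap 0 1 * Equiv.swap 0 4 ∨ ⁅x, y⁆ = Equiv.swap 0 4 * Equiv.swap 0 1 ∨
      ⁅x, y⁆ = Equiv.swap 0 2 * Equiv.swap 0 3 ∨ ⁅x, y⁆ = Equiv.swap 0 3 * Equiv.swap 0 2 := by
      decide
    rcases this with h | h | h | h | h | h | h | h <;> rw [h] <;>
      exact Equiv.Perm.isThreeCycle_swap_mul_swap_same (by decide) (by decide) (by decide)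
  obtain ⟨σ, hσ⟩ := isConj_iff.1 (Equiv.Perm.isConj_iff_cycleType_eq.2 (hxy.trans hg.symm))
  refine ⟨σ * x * σ⁻¹, σ * y * σ⁻¹, ?_, ?_, ?_⟩
  · rw [Equiv.Perm.IsThreeCycle, Equiv.Perm.cycleType_conj]; exact hx
  · rw [Equiv.Perm.IsThreeCycle, Equiv.Perm.cycleType_conj]; exact hy
  · rw [← hσ, commutatorElement_def, commutatorElement_def]
    group

/-! ### Lexicographic conditions -/

/-- The words `u` and `c` agree on the first `l` letters. -/
def agreeOn (l : ℕ) (c u : ℕ → Letter) : Prop := ∀ t < l, u t = c t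

/-- At the first difference of `u` and `c`, which is among the first `l` letters, `R` holds. -/
def firstDiff (R : Letter → Letter → Prop) (l : ℕ) (c u : ℕ → Letter) : Prop :=
  ∃ t < l, (∀ s < t, u s = c s) ∧ R (u t) (c t)

theorem agreeOn_add {m n : ℕ} {c u : ℕ → Letter} :
    agreeOn (m + n) c u ↔ agreeOn m c u ∧ agreeOn n (fun t => c (m + t)) fun t => u (m + t) := by
  refine ⟨fun h => ⟨fun t ht => h t (by omega), fun t ht => h _ (by omega)⟩, ?_⟩
  rintro ⟨h, h'⟩ t ht
  by_cases hm : t < m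
  · exact h t hm
  · have := h' (t - m) (by omega)
    simpa only [show m + (t - m) = t by omega] using this

theorem firstDiff_add {R : Letter → Letter → Prop} {m n : ℕ} {c u : ℕ → Letter} :
    firstDiff R (m + n) c u ↔ firstDiff R m c u ∨
      (agreeOn m c u ∧ firstDiff R n (fun t => c (m + t)) fun t => u (m + t)) := by
  constructor
  · rintro ⟨t, ht, hs, hR⟩
    by_cases hm : t < m
    · exact Or.inl ⟨t, hm, hs, hR⟩
    · refine Or.inr ⟨fun s hs' => hs s (by omega), t - m, by omega,
        fun s hs' => hs _ (by omega), ?_⟩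
      simpa [show m + (t - m) = t by omega] using hR
  · rintro (⟨t, ht, hs, hR⟩ | ⟨h, t, ht, hs, hR⟩)
    · exact ⟨t, by omega, hs, hR⟩
    · exact ⟨m + t, by omega, agreeOn_add.2 ⟨h, hs⟩, hR⟩

theorem not_agreeOn_of_firstDiff {R : Letter → Letter → Prop} (hR : ∀ a, ¬ R a a) {l : ℕ}
    {c u : ℕ → Letter} (h : firstDiff R l c u) : ¬ agreeOn l c u := by
  intro hu
  obtain ⟨t, ht, -, hRt⟩ := h
  rw [hu t ht] at hRt
  exact hR _ hRt

/-- Cost of a gate conditioned on equality with a word of length at most `2 ^ k`. -/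
def agreeCost : ℕ → ℕ
  | 0 => 1
  | k + 1 => 4 * agreeCost k + 4 * numStates * 2 ^ k

/-- Cost of a gate conditioned on a comparison with a word of length at most `2 ^ k`. -/
def diffCost : ℕ → ℕ
  | 0 => 1
  | k + 1 => 3 * diffCost k + 2 * agreeCost k + 4 * numStates * 2 ^ k

theorem agreeCost_add_le (k : ℕ) :
    agreeCost k + 2 * numStates * 2 ^ k ≤ (1 + 2 * numStates) * 4 ^ k := by
  induction k with
  | zero => simp [agreeCost]
  | succ k ih => rw [agreeCost, pow_succ, pow_succ]; nlinarith

theorem diffCost_add_le (k : ℕ) :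
    diffCost k + 4 * numStates * 2 ^ k ≤ 2 * (1 + 2 * numStates) * 4 ^ k := by
  induction k with
  | zero => simp only [diffCost, pow_zero]; omega
  | succ k ih =>
    have := agreeCost_add_le k
    rw [diffCost, pow_succ, pow_succ]
    nlinarith [Nat.zero_le (numStates * 2 ^ k)]

theorem exists_add_of_le_two_pow_succ {k l : ℕ} (hl : l ≤ 2 ^ (k + 1)) :
    ∃ m n, l = m + n ∧ m ≤ 2 ^ k ∧ n ≤ 2 ^ k := by
  rw [pow_succ] at hl
  exact ⟨l / 2, l - l / 2, by omega, by omega, by omega⟩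

theorem cost_agreeOn {ℓ : ℕ} (k : ℕ) : ∀ {l : ℕ}, l ≤ 2 ^ k → ∀ (c : ℕ → Letter)
    {g : Equiv.Perm (Fin 6)}, g.IsThreeCycle → Cost (agreeCost k) (condGate ℓ (agreeOn l c) g) := by
  induction k with
  | zero =>
    intro l hl c g _
    rw [condGate_congr (P' := fun u => l = 0 ∨ u 0 = c 0)]
    · exact cost_condGate_letter fun a => l = 0 ∨ a = c 0
    · intro u
      obtain rfl | rfl : l = 0 ∨ l = 1 := by rw [pow_zero] at hl; omega
      all_goals simp [agreeOn]
  | succ k ih =>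
    intro l hl c g hg
    obtain ⟨m, n, rfl, hm, hn⟩ := exists_add_of_le_two_pow_succ hl
    obtain ⟨a, b, ha, hb, rfl⟩ := hg.exists_commutator
    rw [condGate_congr fun u => agreeOn_add, condGate_and]
    refine ((ih hm c ha).commutator ((ih hn _ hb).condGate_shift m)).mono ?_
    have := Nat.mul_le_mul_left (numStates) hm
    rw [agreeCost]
    nlinarith

theorem cost_firstDiff {ℓ : ℕ} {R : Letter → Letter → Prop} (hR : ∀ a, ¬ R a a) (k : ℕ) :
    ∀ {l : ℕ}, l ≤ 2 ^ k → ∀ (c : ℕ → Letter) {g : Equiv.Perm (Fin 6)}, g.IsThreeCycle →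
      Cost (diffCost k) (condGate ℓ (firstDiff R l c) g) := by
  induction k with
  | zero =>
    intro l hl c g _
    rw [condGate_congr (P' := fun u => l = 1 ∧ R (u 0) (c 0))]
    · exact cost_condGate_letter fun a => l = 1 ∧ R a (c 0)
    · intro u
      obtain rfl | rfl : l = 0 ∨ l = 1 := by rw [pow_zero] at hl; omega
      all_goals simp [firstDiff]
  | succ k ih =>
    intro l hl c g hg
    obtain ⟨m, n, rfl, hm, hn⟩ := exists_add_of_le_two_pow_succ hl
    rw [condGate_congr fun u => firstDiff_add,
      condGate_or fun u h h' => not_agreeOn_of_firstDiff hR h h'.1]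
    have hfirst := ih hm c hg
    obtain ⟨a, b, ha, hb, rfl⟩ := hg.exists_commutator
    rw [condGate_and]
    refine (hfirst.mul ((cost_agreeOn k hm c ha).commutator
      ((ih hn _ hb).condGate_shift m))).mono ?_
    have := Nat.mul_le_mul_left (numStates) hm
    rw [diffCost]
    nlinarith

theorem exists_le_two_pow {l : ℕ} (hl : 1 ≤ l) : ∃ k, l ≤ 2 ^ k ∧ 4 ^ k ≤ 4 * l ^ 2 := by
  refine ⟨Nat.clog 2 l, Nat.le_pow_clog (by norm_num) l, ?_⟩
  have hkl : 2 ^ Nat.clog 2 l ≤ 2 * l := by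
    rcases hl.eq_or_lt with rfl | hl
    · simp
    · have h := Nat.pow_pred_clog_lt_self (b := 2) (by norm_num) hl
      obtain ⟨j, hj⟩ := Nat.exists_eq_succ_of_ne_zero (Nat.clog_pos one_lt_two hl).ne'
      rw [hj, Nat.pred_succ] at h
      rw [hj, pow_succ]
      omega
  calc 4 ^ Nat.clog 2 l = (2 ^ Nat.clog 2 l) ^ 2 := by
        rw [← pow_mul, mul_comm, pow_mul]; rfl
    _ ≤ (2 * l) ^ 2 := Nat.pow_le_pow_left hkl 2
    _ = 4 * l ^ 2 := by ring

theorem cost_lexHolds_of_isThreeCycle {g : Equiv.Perm (Fin 6)} (hg : g.IsThreeCycle)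
    (ℓ : ℕ) {l : ℕ} (hl : 1 ≤ l) (c : ℕ → Letter) (r : CmpRel) :
    Cost (12 * (1 + 2 * numStates) * l ^ 2) (condGate ℓ (fun u => lexHolds r l u c) g) := by
  obtain ⟨k, hlk, hsq⟩ := exists_le_two_pow hl
  have hA := agreeCost_add_le k
  have hD := diffCost_add_le k
  have hsum : diffCost k + agreeCost k ≤ 12 * (1 + 2 * numStates) * l ^ 2 := by
    have := Nat.mul_le_mul_left (3 * (1 + 2 * numStates)) hsq
    linarith [Nat.zero_le (numStates * 2 ^ k)]
  have heq : Cost (agreeCost k) (condGate ℓ (agreeOn l c) g) := cost_agreeOn k hlk c hg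
  have hlt : Cost (diffCost k) (condGate ℓ (firstDiff (· < ·) l c) g) :=
    cost_firstDiff (R := (· < ·)) lt_irrefl k hlk c hg
  have hgt : Cost (diffCost k) (condGate ℓ (firstDiff (fun a b => b < a) l c) g) :=
    cost_firstDiff (R := fun a b => b < a) lt_irrefl k hlk c hg
  have hswap (u : ℕ → Letter) : lexLt l c u ↔ firstDiff (fun a b => b < a) l c u := by
    simp only [lexLt, firstDiff, eq_comm]
  have hle : Cost (diffCost k + agreeCost k)
      (condGate ℓ (fun u => firstDiff (· < ·) l c u ∨ agreeOn l c u) g) := by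
    rw [condGate_or fun u => not_agreeOn_of_firstDiff (R := (· < ·)) lt_irrefl]
    exact hlt.mul heq
  have hge : Cost (diffCost k + agreeCost k)
      (condGate ℓ (fun u => firstDiff (fun a b => b < a) l c u ∨ agreeOn l c u) g) := by
    rw [condGate_or fun u => not_agreeOn_of_firstDiff (R := fun a b => b < a) lt_irrefl]
    exact hgt.mul heq
  have hcongr {P : (ℕ → Letter) → Prop} (hP : ∀ u, lexHolds r l u c ↔ P u)
      (h : Cost (diffCost k + agreeCost k) (condGate ℓ P g)) :
      Cost (12 * (1 + 2 * numStates) * l ^ 2) (condGate ℓ (fun u => lexHolds r l u c) g) := by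
    rw [condGate_congr hP]
    exact h.mono hsum
  cases r with
  | eq => exact hcongr (fun _ => Iff.rfl) (heq.mono (Nat.le_add_left _ _))
  | lt => exact hcongr (fun _ => Iff.rfl) (hlt.mono (Nat.le_add_right _ _))
  | gt => exact hcongr hswap (hgt.mono (Nat.le_add_right _ _))
  | le => exact hcongr (fun _ => Iff.rfl) hle
  | ge => exact hcongr (fun u => or_congr_left (hswap u)) hge

theorem exists_cost_lexHolds (g : Equiv.Perm (Fin 6)) (hg : Equiv.Perm.sign g = 1) :
    ∃ K : ℕ, ∀ ℓ l : ℕ, 1 ≤ l → ∀ (c : ℕ → Letter) (r : CmpRel),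
      Cost (K * l ^ 2) (condGate ℓ (fun u => lexHolds r l u c) g) := by
  rw [← Equiv.Perm.mem_alternatingGroup, ← Equiv.Perm.closure_three_cycles_eq_alternating] at hg
  induction hg using Subgroup.closure_induction with
  | mem g hg => exact ⟨_, fun ℓ l hl c r => cost_lexHolds_of_isThreeCycle hg ℓ hl c r⟩
  | one => exact ⟨0, fun ℓ l _ c r => by rw [condGate_one]; exact Cost.one⟩
  | mul g h _ _ ihg ihh =>
    obtain ⟨K, hK⟩ := ihg
    obtain ⟨K', hK'⟩ := ihh
    refine ⟨K + K', fun ℓ l hl c r => ?_⟩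
    rw [condGate_mul, add_mul]
    exact (hK ℓ l hl c r).mul (hK' ℓ l hl c r)
  | inv g _ ih =>
    obtain ⟨K, hK⟩ := ih
    refine ⟨K, fun ℓ l hl c r => ?_⟩
    rw [condGate_inv]
    exact (hK ℓ l hl c r).inv

/-- **Lemma.** There is a constant `K > 0` such that for every `ℓ ≥ 2`, every `1 ≤ l ≤ ℓ`,
every word `c ∈ {0,1,2}^l`, every lexicographic comparison `∼` and every even permutation
`g` of the ghost set `G = {0,…,5}`, the conditioned gate `π_{id×g, ∼c}` — applying `id×g`
to the head symbol exactly when the `l` tape letters read from the head satisfy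
`a₀⋯a_{l−1} ∼ c` — belongs to `G_ℓ` with word norm at most `K·l²`. -/
theorem lex_conditioned_ghost_gate :
    ∃ K : ℝ, 0 < K ∧ ∀ ℓ : ℕ, 2 ≤ ℓ → ∀ l : ℕ, 1 ≤ l → l ≤ ℓ →
      ∀ c : ℕ → Letter, ∀ r : CmpRel, ∀ g : Equiv.Perm (Fin 6),
        Equiv.Perm.sign g = 1 →
        ∃ π : Equiv.Perm (CConf DQ Letter ℓ),
          π ∈ Subgroup.closure (TMGens DQ Letter ℓ) ∧
          (∀ w : CConf DQ Letter ℓ,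
            ((∀ i : ZMod ℓ, (w.1 i).isLeft = true) → π w = w) ∧
            (∀ (i₀ : ZMod ℓ) (sq : SQ) (d : Fin 2) (x : Fin 6) (a : Letter),
              w.1 i₀ = Sum.inr ((sq, d, x), a) →
              ((lexHolds r l (readWord ℓ w.1 i₀) c →
                  (π w).1 = Function.update w.1 i₀ (Sum.inr ((sq, d, g x), a))) ∧
               (¬ lexHolds r l (readWord ℓ w.1 i₀) c → π w = w)))) ∧
          (wordNorm (TMGens DQ Letter ℓ) π : ℝ) ≤ K * (l : ℝ) ^ 2 := by
  choose K hK using exists_cost_lexHolds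
  refine ⟨1 + ∑ g, if hg : Equiv.Perm.sign g = 1 then (K g hg : ℝ) else 0, ?_, ?_⟩
  · exact add_pos_of_pos_of_nonneg one_pos (Finset.sum_nonneg fun g _ => by split_ifs <;> positivity)
  intro ℓ _ l hl _ c r g hg
  have hcost := hK g hg ℓ l hl c r
  refine ⟨liftPerm ℓ (condGate ℓ (fun u => lexHolds r l u c) g), hcost.mem_closure,
    fun w => ⟨fun hw => ?_, fun i₀ sq d x a hw => ?_⟩, ?_⟩
  · rw [eq_blankConf w hw, liftPerm_blankConf]
  · have hcw := eq_headConf w hw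
    refine ⟨fun h => ?_, fun h => ?_⟩
    · have h' : lexHolds r l (fun t => tapeLetter (w.1 (i₀ + t))) c := h
      conv_lhs => rw [hcw, liftPerm_headConf]
      funext j
      by_cases hj : j = i₀
      · subst hj
        simp [headConf, condGate, ghostGate, onWord, h']
        simp [hw, tapeLetter]
      · have hwj := congrArg (fun v => v.1 j) hcw
        simp only [headConf, if_neg hj] at hwj
        rw [Function.update_of_ne hj, hwj]
        simp [headConf, condGate, ghostGate, hj]
    · have h' : ¬ lexHolds r l (fun t => tapeLetter (w.1 (i₀ + t))) c := h
      conv_lhs => rw [hcw, liftPerm_headConf]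
      conv_rhs => rw [hcw]
      simp [condGate, ghostGate, onWord, h']
  · have hnorm : (wordNorm (TMGens DQ Letter ℓ)
        (liftPerm ℓ (condGate ℓ (fun u => lexHolds r l u c) g)) : ℝ) ≤ K g hg * (l : ℝ) ^ 2 := by
      exact_mod_cast hcost.wordNorm_le
    refine hnorm.trans (mul_le_mul_of_nonneg_right ?_ (by positivity))
    have hle := Finset.single_le_sum
      (f := fun g => if hg : Equiv.Perm.sign g = 1 then (K g hg : ℝ) else 0)
      (fun g _ => by split_ifs <;> positivity) (Finset.mem_univ g)
    simp only [dif_pos hg] at hle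
    linarith
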